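/- Let m be a positive integer and let Γ be a polycyclic subgroup of GL_m(ℝ). Then there exists a subgroup H of GL_m(ℝ) of countable index in GL_m(ℝ) which intersects Γ trivially, i.e. H ∩ Γ = {1}. -/

import Mathlib

/-- A group is polycyclic if it admits a finite subnormal series with cyclic quotients. -/
def IsPolycyclic (G : Type*) [Group G] : Prop :=
  ∃ (d : ℕ) (s : Fin (d + 1) → Subgroup G),
    s 0 = ⊥ ∧ s (Fin.last d) = ⊤ ∧
    ∀ i : Fin d, s i.castSucc ≤ s i.succ ∧
      ∃ hn : ((s i.castSucc).subgroupOf (s i.succ)).Normal,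
        letI := hn
        IsCyclic (↥(s i.succ) ⧸ (s i.castSucc).subgroupOf (s i.succ))

open scoped Matrix Cardinal PowerSeries

theorem Valuation.matrix_mul_apply_lt_one {R Γ₀ n : Type*} [Fintype n] [CommRing R]
    [LinearOrderedCommGroupWithZero Γ₀] (v : Valuation R Γ₀) {A B : Matrix n n R}
    (hA : ∀ i j, v (A i j) ≤ 1) (hB : ∀ i j, v (B i j) < 1) (i j : n) : v ((A * B) i j) < 1 := by
  rw [Matrix.mul_apply]
  refine v.map_sum_lt one_ne_zero fun k _ => ?_
  rw [map_mul]
  exact mul_lt_one_of_nonneg_of_lt_one_right (hA i k) zero_le (hB k j)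

/-- The invertible matrices congruent to `1`, together with their inverses, modulo the elements
of valuation less than `1`. -/
def Valuation.congruenceSubgroup {R Γ₀ : Type*} (n : Type*) [Fintype n] [DecidableEq n] [CommRing R]
    [LinearOrderedCommGroupWithZero Γ₀] (v : Valuation R Γ₀) : Subgroup (GL n R) where
  carrier := {g | (∀ i j, v ((g.val - 1) i j) < 1) ∧ ∀ i j, v ((g⁻¹.val - 1) i j) < 1}
  one_mem' := by simp
  inv_mem' h := ⟨h.2, by simpa using h.1⟩
  mul_mem' := by
    have key (A B : Matrix n n R) (hA : ∀ i j, v ((A - 1) i j) < 1)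
        (hB : ∀ i j, v ((B - 1) i j) < 1) (i j : n) : v ((A * B - 1) i j) < 1 := by
      have h : A * B - 1 = (A - 1) * (B - 1) + (A - 1) + (B - 1) := by noncomm_ring
      rw [h]
      exact v.map_add_lt (v.map_add_lt
        (v.matrix_mul_apply_lt_one (fun i j => (hA i j).le) hB i j) (hA i j)) (hB i j)
    intro g h hg hh
    refine ⟨fun i j => ?_, fun i j => ?_⟩
    · simpa using key _ _ hg.1 hh.1 i j
    · rw [mul_inv_rev]
      exact key _ _ hh.2 hg.2 i j

theorem Valuation.countable_quotient_congruenceSubgroup {K Γ₀ n : Type*} [Fintype n]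
    [DecidableEq n] [Field K] [LinearOrderedCommGroupWithZero Γ₀] (v : Valuation K Γ₀)
    {S : Set K} (hS : S.Countable) (hdense : ∀ x, ∃ s ∈ S, v (x - s) < 1)
    {t : K} (ht : t ≠ 0) (ht1 : v t ≤ 1) (hcofinal : ∀ x, ∃ N : ℕ, v (t ^ N * x) ≤ 1) :
    Countable (GL n K ⧸ v.congruenceSubgroup n) := by
  have : Countable S := hS
  have hbdd (g : GL n K) : ∃ N : ℕ, ∀ i j, v (t ^ N * g⁻¹.val i j) ≤ 1 := by
    choose N hN using hcofinal
    refine ⟨Finset.univ.sup fun p : n × n => N (g⁻¹.val p.1 p.2), fun i j => ?_⟩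
    obtain ⟨d, hd⟩ := Nat.exists_eq_add_of_le'
      (Finset.le_sup (f := fun p : n × n => N (g⁻¹.val p.1 p.2)) (Finset.mem_univ (i, j)))
    rw [hd, pow_add, mul_assoc, map_mul, map_pow]
    exact mul_le_one' (pow_le_one' ht1 d) (hN _)
  choose N hN using hbdd
  choose s hsS hs using hdense
  let F (g : GL n K) : ℕ × (n → n → S) :=
    (N g, fun i j => ⟨s ((t ^ N g)⁻¹ * g.val i j), hsS _⟩)
  have key (g h : GL n K) (hgh : F g = F h) (i j : n) :
      v (((g⁻¹ * h).val - 1) i j) < 1 := by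
    obtain ⟨h1, h2⟩ := Prod.ext_iff.1 hgh
    change N g = N h at h1
    have hF (i j : n) : v (((t ^ N g)⁻¹ • (h.val - g.val)) i j) < 1 := by
      have h3 : s ((t ^ N g)⁻¹ * g.val i j) = s ((t ^ N h)⁻¹ * h.val i j) :=
        congrArg Subtype.val (congrFun₂ h2 i j)
      have h4 := v.map_sub_lt (hs ((t ^ N h)⁻¹ * h.val i j)) (hs ((t ^ N g)⁻¹ * g.val i j))
      rwa [h3, sub_sub_sub_cancel_right, ← h1, ← mul_sub] at h4
    have hprod : (g⁻¹ * h).val - 1 =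
        (t ^ N g • g⁻¹.val) * ((t ^ N g)⁻¹ • (h.val - g.val)) := by
      rw [Matrix.smul_mul, Matrix.mul_smul, smul_smul, mul_inv_cancel₀ (pow_ne_zero _ ht), one_smul,
        mul_sub, ← Units.val_mul, ← Units.val_mul, inv_mul_cancel, Units.val_one]
    rw [hprod]
    exact v.matrix_mul_apply_lt_one (hN g) hF i j
  refine Function.Injective.countable (f := fun q : GL n K ⧸ v.congruenceSubgroup n => F q.out)
    fun p q hpq => ?_
  rw [← p.out_eq', ← q.out_eq', QuotientGroup.eq]
  refine ⟨key _ _ hpq, ?_⟩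
  simpa only [mul_inv_rev, inv_inv] using key _ _ hpq.symm

theorem Subgroup.countable_quotient_comap {G G' : Type*} [Group G] [Group G'] (f : G →* G')
    (H : Subgroup G') [Countable (G' ⧸ H)] : Countable (G ⧸ H.comap f) := by
  refine Function.Injective.countable
    (f := fun q : G ⧸ H.comap f => (QuotientGroup.mk (f q.out) : G' ⧸ H)) fun p q hpq => ?_
  rw [← p.out_eq', ← q.out_eq', QuotientGroup.eq]
  simpa using QuotientGroup.eq.1 hpq

theorem Subgroup.countable_of_countable_quotient {G : Type*} [Group G] (H : Subgroup G)
    [Countable H] [Countable (G ⧸ H)] : Countable G :=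
  (Subgroup.groupEquivQuotientProdSubgroup (s := H)).injective.countable

theorem IsCyclic.countable (G : Type*) [Group G] [IsCyclic G] : Countable G := by
  obtain ⟨g, hg⟩ := IsCyclic.exists_generator (α := G)
  exact Function.Surjective.countable (f := fun n : ℤ => g ^ n) hg

theorem IsPolycyclic.countable {G : Type*} [Group G] (hG : IsPolycyclic G) : Countable G := by
  obtain ⟨d, s, h0, hd, hs⟩ := hG
  have h (i : Fin (d + 1)) : Countable (s i) := by
    induction i using Fin.induction with
    | zero => rw [h0]; infer_instance
    | succ i ih =>
      obtain ⟨hle, hn, hc⟩ := hs i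
      have := IsCyclic.countable (s i.succ ⧸ (s i.castSucc).subgroupOf (s i.succ))
      have : Countable ((s i.castSucc).subgroupOf (s i.succ)) :=
        (Subgroup.subgroupOfEquivOfLe hle).injective.countable
      exact Subgroup.countable_of_countable_quotient ((s i.castSucc).subgroupOf (s i.succ))
  have := h (Fin.last d)
  rw [hd] at this
  exact Subgroup.topEquiv.symm.injective.countable

theorem exists_algHom_of_isAlgClosed_of_cardinal_le {k F Ω : Type} [Field k] [Countable k]
    [Field F] [Algebra k F] [Field Ω] [Algebra k Ω] [IsAlgClosed Ω]
    (hΩ : ℵ₀ < #Ω) (hF : #F ≤ #Ω) : Nonempty (F →ₐ[k] Ω) := by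
  obtain ⟨s, hs⟩ := exists_isTranscendenceBasis k F
  obtain ⟨u, hu⟩ := exists_isTranscendenceBasis k Ω
  have hcard := IsAlgClosed.cardinal_eq_cardinal_transcendence_basis_of_aleph0_lt' _ hu
    Cardinal.mk_le_aleph0 hΩ
  obtain ⟨e⟩ : #s ≤ #u := (Cardinal.mk_set_le s).trans (hF.trans hcard.le)
  have hy : AlgebraicIndependent k fun i : s => (e i : Ω) := hu.1.comp e e.injective
  let A := Algebra.adjoin k (Set.range ((↑) : s → F))
  let f : A →ₐ[k] Ω := (MvPolynomial.aeval fun i : s => (e i : Ω)).comp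
    (hs.1.aevalEquiv.symm : A →ₐ[k] MvPolynomial s k)
  have hf : Function.Injective f := by
    have := algebraicIndependent_iff_injective_aeval.1 hy
    exact this.comp hs.1.aevalEquiv.symm.injective
  let : Algebra A Ω := f.toRingHom.toAlgebra
  have : IsScalarTower k A Ω := .of_algebraMap_eq fun x => (f.commutes x).symm
  have : FaithfulSMul A Ω := (faithfulSMul_iff_algebraMap_injective A Ω).2 hf
  have : Algebra.IsAlgebraic A F := hs.isAlgebraic
  exact ⟨(IsAlgClosed.lift (R := A) (S := F) (M := Ω)).restrictScalars k⟩

theorem Multiset.exists_lt_of_prod_map_lt_pow {α M : Type*} [CommMonoid M] [LinearOrder M]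
    [MulLeftMono M] {s : Multiset α} {f : α → M} {c : M}
    (h : (s.map f).prod < c ^ s.card) : ∃ a ∈ s, f a < c := by
  by_contra! hc
  refine h.not_ge ?_
  simpa using Multiset.pow_card_le_prod (s := s.map f) (a := c) (by simpa using hc)

/-- Modulo a power of `X`, a monic polynomial over `k⟦X⟧` comes from one over `k[X]`. -/
theorem PowerSeries.exists_monic_map_eq_add_X_pow_mul {k : Type*} [Field k]
    {p : Polynomial k⟦X⟧} (hp : p.Monic) (N : ℕ) :
    ∃ q : Polynomial (Polynomial k), q.Monic ∧ q.natDegree = p.natDegree ∧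
      ∃ r : Polynomial k⟦X⟧,
        q.map (algebraMap (Polynomial k) k⟦X⟧) = p + Polynomial.C (X ^ (N + 1)) * r := by
  let π := Ideal.Quotient.mk (Ideal.span {(X : k⟦X⟧) ^ (N + 1)})
  let ψ := π.comp (algebraMap (Polynomial k) k⟦X⟧)
  have hψ : Function.Surjective ψ := by
    intro y
    obtain ⟨a, rfl⟩ := Ideal.Quotient.mk_surjective y
    refine ⟨trunc (N + 1) a, Ideal.Quotient.eq.2 ?_⟩
    rw [Ideal.mem_span_singleton, ← neg_sub, dvd_neg]
    nth_rw 1 [eq_X_pow_mul_shift_add_trunc (N + 1) a]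
    simp [algebraMap_apply']
  have : Nontrivial (k⟦X⟧ ⧸ Ideal.span {(X : k⟦X⟧) ^ (N + 1)}) := by
    rw [Ideal.Quotient.nontrivial_iff, Ne, Ideal.span_singleton_eq_top]
    exact fun h => X_prime.not_isUnit (isUnit_of_dvd_unit (dvd_pow_self X N.succ_ne_zero) h)
  obtain ⟨q, hq, hdeg, hmonic⟩ := Polynomial.lifts_and_natDegree_eq_and_monic (f := ψ)
    (p := p.map π) ((Polynomial.lifts_iff_coeff_lifts _).2 fun n => hψ _) (hp.map π)
  refine ⟨q, hmonic, hdeg.trans (hp.natDegree_map π), ?_⟩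
  have hdvd : Polynomial.C (X ^ (N + 1)) ∣ q.map (algebraMap (Polynomial k) k⟦X⟧) - p := by
    rw [Polynomial.C_dvd_iff_dvd_coeff]
    intro i
    rw [← Ideal.mem_span_singleton, ← Ideal.Quotient.eq_zero_iff_mem, Polynomial.coeff_sub, map_sub,
      sub_eq_zero]
    have h := congrArg (fun f => Polynomial.coeff f i) hq
    rwa [Polynomial.coeff_map, Polynomial.coeff_map, RingHom.comp_apply, ← Polynomial.coeff_map] at h
  obtain ⟨r, hr⟩ := hdvd
  exact ⟨r, by rw [← hr]; ring⟩

theorem ValuationSubring.valuation_le_one_of_isIntegral {R K : Type*} [CommRing R] [Field K]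
    [Algebra R K] (V : ValuationSubring K) (hV : ∀ a : R, algebraMap R K a ∈ V) {x : K}
    (hx : IsIntegral R x) : V.valuation x ≤ 1 := by
  rw [V.valuation_le_one_iff]
  have hx' : IsIntegral V x := hx.map_of_comp_eq
    ((algebraMap R K).codRestrict V.toSubring hV) (RingHom.id K) rfl
  obtain ⟨y, rfl⟩ := IsIntegrallyClosed.isIntegral_iff.1 hx'
  exact y.2

theorem PowerSeries.exists_isIntegral_X_pow_mul {k Ω : Type*} [Field k] [Field Ω]
    [Algebra k⟦X⟧ Ω] {x : Ω} (hx : IsAlgebraic k⟦X⟧ x) :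
    ∃ N : ℕ, IsIntegral k⟦X⟧ (algebraMap k⟦X⟧ Ω X ^ N * x) := by
  obtain ⟨y, hy, hint⟩ := hx.exists_integral_multiple
  obtain ⟨u, hu⟩ := isUnit_divided_by_X_pow_order hy
  refine ⟨y.order.toNat, ?_⟩
  have h := hint.smul (↑u⁻¹ : k⟦X⟧)
  have hX : (↑u⁻¹ : k⟦X⟧) * y = X ^ y.order.toNat := by
    conv_lhs => rw [← X_pow_order_mul_divXPowOrder (f := y), ← hu]
    rw [mul_left_comm, Units.inv_mul, mul_one]
  rwa [smul_smul, hX, Algebra.smul_def, map_pow] at h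

/-- Elements algebraic over `k[X]` are dense in an algebraically closed algebraic extension
of `k⟦X⟧`. -/
theorem PowerSeries.exists_isAlgebraic_valuation_sub_lt_one {k Ω : Type*} [Field k] [Field Ω]
    [IsAlgClosed Ω] [Algebra k⟦X⟧ Ω] [Algebra (Polynomial k) Ω]
    [IsScalarTower (Polynomial k) k⟦X⟧ Ω] [FaithfulSMul k⟦X⟧ Ω] [Algebra.IsAlgebraic k⟦X⟧ Ω]
    (V : ValuationSubring Ω) (hV : ∀ a, algebraMap k⟦X⟧ Ω a ∈ V)
    (hX : V.valuation (algebraMap k⟦X⟧ Ω X) < 1) (x : Ω) :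
    ∃ s, IsAlgebraic (Polynomial k) s ∧ V.valuation (x - s) < 1 := by
  set v := V.valuation
  set t := algebraMap k⟦X⟧ Ω X
  have ht : t ≠ 0 := by simp [t, X_ne_zero]
  have hvt : 0 < v t := zero_lt_iff.2 ((map_ne_zero v).2 ht)
  obtain ⟨M, hM⟩ := exists_isIntegral_X_pow_mul (Algebra.IsAlgebraic.isAlgebraic (R := k⟦X⟧) x)
  set y := t ^ M * x
  obtain ⟨p, hp, hpy⟩ := hM
  obtain ⟨q, hq, hdeg, r, hr⟩ := exists_monic_map_eq_add_X_pow_mul hp (M * p.natDegree)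
  have hvy : v y ≤ 1 := V.valuation_le_one_of_isIntegral hV ⟨p, hp, hpy⟩
  have hvr : v (r.eval₂ (algebraMap _ Ω) y) ≤ 1 := by
    rw [Polynomial.eval₂_eq_sum]
    refine v.map_sum_le fun i _ => ?_
    rw [map_mul, map_pow]
    exact mul_le_one' ((V.valuation_le_one_iff _).2 (hV _)) (pow_le_one' hvy i)
  let Q := q.map (algebraMap (Polynomial k) Ω)
  have hQ : Q.eval y = t ^ (M * p.natDegree + 1) * r.eval₂ (algebraMap _ Ω) y := by
    have h := congrArg (Polynomial.eval₂ (algebraMap k⟦X⟧ Ω) y) hr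
    rw [Polynomial.eval₂_map, ← IsScalarTower.algebraMap_eq, Polynomial.eval₂_add, hpy, zero_add,
      Polynomial.eval₂_mul, Polynomial.eval₂_C, map_pow] at h
    rwa [Polynomial.eval_map]
  have hcard : Q.roots.card = p.natDegree := by
    rw [← (IsAlgClosed.splits Q).natDegree_eq_card_roots, hq.natDegree_map, hdeg]
  have hprod : (Q.roots.map fun z => v (y - z)).prod < (v t ^ M) ^ Q.roots.card := by
    have h := congrArg v ((IsAlgClosed.splits Q).eval_eq_prod_roots_of_monic (hq.map _) y)
    rw [map_multiset_prod, Multiset.map_map] at h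
    refine h.symm.trans_lt ?_
    rw [hQ, map_mul, map_pow, pow_succ, hcard, ← pow_mul, mul_assoc]
    exact mul_lt_of_lt_one_right (pow_pos hvt _) (mul_lt_one_of_lt_of_le hX hvr)
  obtain ⟨z, hz, hyz⟩ := Multiset.exists_lt_of_prod_map_lt_pow hprod
  have hzalg : IsAlgebraic (Polynomial k) z :=
    ⟨q, hq.ne_zero, by
      simpa [Q, Polynomial.aeval_def, Polynomial.eval_map] using (Polynomial.mem_roots'.1 hz).2⟩
  have htalg : IsAlgebraic (Polynomial k) t := by
    have h : t = algebraMap (Polynomial k) Ω Polynomial.X := by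
      rw [IsScalarTower.algebraMap_apply (Polynomial k) k⟦X⟧ Ω, algebraMap_apply']
      simp [t]
    rw [h]
    exact isAlgebraic_algebraMap _
  refine ⟨(t ^ M)⁻¹ * z, (htalg.pow M).inv.mul hzalg, ?_⟩
  have h : x - (t ^ M)⁻¹ * z = (t ^ M)⁻¹ * (y - z) := by
    rw [mul_sub, inv_mul_cancel_left₀ (pow_ne_zero _ ht)]
  rw [h, map_mul, map_inv₀, map_pow]
  exact (inv_mul_lt_one₀ (pow_pos hvt _)).2 hyz

theorem Polynomial.countable (R : Type*) [Semiring R] [Countable R] : Countable (Polynomial R) :=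
  Cardinal.mk_le_aleph0_iff.1
    (Polynomial.cardinalMk_le_max.trans (max_le Cardinal.mk_le_aleph0 le_rfl))

/-- Every countable field `k` of coefficients embeds into an algebraically closed valued field
of cardinality at least the continuum, with `k` trivially valued and only countably many residue
classes modulo the elements of valuation less than `1`. -/
theorem exists_isAlgClosed_valuationSubring_countable_residues (k : Type) [Field k] [Countable k] :
    ∃ (Ω : Type) (_ : Field Ω) (_ : IsAlgClosed Ω) (_ : Algebra k Ω) (V : ValuationSubring Ω)
      (S : Set Ω) (t : Ω), 𝔠 ≤ #Ω ∧ (∀ a : k, V.valuation (algebraMap k Ω a) < 1 → a = 0) ∧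
      S.Countable ∧ (∀ x, ∃ s ∈ S, V.valuation (x - s) < 1) ∧ t ≠ 0 ∧ V.valuation t ≤ 1 ∧
      ∀ x, ∃ N : ℕ, V.valuation (t ^ N * x) ≤ 1 := by
  let F := FractionRing k⟦X⟧
  let Ω := AlgebraicClosure F
  have hinj : Function.Injective (algebraMap k⟦X⟧ Ω) := by
    rw [IsScalarTower.algebraMap_eq k⟦X⟧ F Ω]
    exact (algebraMap F Ω).injective.comp (IsFractionRing.injective k⟦X⟧ F)
  have : FaithfulSMul k⟦X⟧ Ω := (faithfulSMul_iff_algebraMap_injective _ _).2 hinj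
  have : Algebra.IsAlgebraic k⟦X⟧ F := IsLocalization.isAlgebraic F (nonZeroDivisors k⟦X⟧)
  have : Algebra.IsAlgebraic k⟦X⟧ Ω := Algebra.IsAlgebraic.trans k⟦X⟧ F Ω
  obtain ⟨V, hV, hloc⟩ := IsLocalRing.exists_factor_valuationRing (algebraMap k⟦X⟧ Ω)
  have hunit (a : k⟦X⟧) : V.valuation (algebraMap k⟦X⟧ Ω a) < 1 ↔ ¬ IsUnit a := by
    rw [← isUnit_map_iff ((algebraMap k⟦X⟧ Ω).codRestrict V.toSubring hV) a]
    exact (V.valuation_lt_one_iff ⟨algebraMap k⟦X⟧ Ω a, hV a⟩).symm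
  have hX : V.valuation (algebraMap k⟦X⟧ Ω PowerSeries.X) < 1 :=
    (hunit _).2 PowerSeries.X_prime.not_isUnit
  have hcountable : {s : Ω | IsAlgebraic (Polynomial k) s}.Countable := by
    have := Polynomial.countable k
    have : FaithfulSMul (Polynomial k) Ω := by
      rw [faithfulSMul_iff_algebraMap_injective, IsScalarTower.algebraMap_eq (Polynomial k) k⟦X⟧ Ω]
      exact hinj.comp fun p q h => by simpa [PowerSeries.algebraMap_apply'] using h
    exact Algebraic.countable (Polynomial k) Ω
  refine ⟨Ω, inferInstance, inferInstance, inferInstance, V, _, algebraMap k⟦X⟧ Ω PowerSeries.X,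
    ?_, fun a ha => ?_, hcountable,
    PowerSeries.exists_isAlgebraic_valuation_sub_lt_one V hV hX, by simp [PowerSeries.X_ne_zero],
    hX.le, fun x => ?_⟩
  · have h : #(Set ℕ) ≤ #Ω := by
      classical
      refine Cardinal.mk_le_of_injective
        (f := fun s : Set ℕ => algebraMap k⟦X⟧ Ω (PowerSeries.mk fun n => if n ∈ s then 1 else 0))
        (hinj.comp fun s u hsu => Set.ext fun n => ?_)
      have h := congrArg (PowerSeries.coeff n) hsu
      simp only [PowerSeries.coeff_mk] at h
      by_cases h1 : n ∈ s <;> by_cases h2 : n ∈ u <;> simp [h1, h2] at h ⊢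
    simpa using h
  · by_contra h0
    rw [IsScalarTower.algebraMap_apply k k⟦X⟧ Ω, hunit] at ha
    exact ha ((IsUnit.mk0 a h0).map _)
  · obtain ⟨N, hN⟩ := PowerSeries.exists_isIntegral_X_pow_mul
      (Algebra.IsAlgebraic.isAlgebraic (R := k⟦X⟧) x)
    exact ⟨N, V.valuation_le_one_of_isIntegral hV hN⟩

/-- Any countable subgroup of `GL_n` of a field of cardinality at most the continuum is avoided by
a subgroup of countable index. -/
theorem exists_countable_index_subgroup_inf_eq_bot_of_countable {F : Type} [Field F]
    (hF : #F ≤ 𝔠) {n : Type*} [Fintype n] [DecidableEq n] (Γ : Subgroup (GL n F)) [Countable Γ] :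
    ∃ H : Subgroup (GL n F), Countable (GL n F ⧸ H) ∧ H ⊓ Γ = ⊥ := by
  let E : Set F := Set.range fun p : Γ × n × n => p.1.1.val p.2.1 p.2.2
  let k := Subfield.closure E
  have : Countable k := Cardinal.mk_le_aleph0_iff.1 <|
    (Subfield.cardinalMk_closure_le_max E).trans
      (max_le (Cardinal.le_aleph0_iff_set_countable.2 (Set.countable_range _)) le_rfl)
  obtain ⟨Ω, _, _, _, V, S, t, hΩ, hk, hS, hdense, ht, ht1, hcofinal⟩ :=
    exists_isAlgClosed_valuationSubring_countable_residues k
  obtain ⟨φ⟩ := exists_algHom_of_isAlgClosed_of_cardinal_le (k := k) (F := F)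
    (Cardinal.aleph0_lt_continuum.trans_le hΩ) (hF.trans hΩ)
  have := V.valuation.countable_quotient_congruenceSubgroup (n := n) hS hdense ht ht1 hcofinal
  let f : GL n F →* GL n Ω := Matrix.GeneralLinearGroup.map φ.toRingHom
  refine ⟨(V.valuation.congruenceSubgroup n).comap f, Subgroup.countable_quotient_comap f _, ?_⟩
  rw [eq_bot_iff]
  rintro g ⟨hg, hgΓ⟩
  refine Subgroup.mem_bot.2 (Units.ext (Matrix.ext fun i j => ?_))
  have hmem : (g.val - 1) i j ∈ k := by
    refine k.sub_mem (Subfield.subset_closure ⟨(⟨g, hgΓ⟩, i, j), rfl⟩) ?_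
    rw [Matrix.one_apply]
    split_ifs
    exacts [k.one_mem, k.zero_mem]
  have h : V.valuation (algebraMap k Ω ⟨(g.val - 1) i j, hmem⟩) < 1 := by
    have h1 := hg.1 i j
    rw [← φ.commutes]
    have h2 : ((f g).val - 1) i j = φ ((g.val - 1) i j) := by
      simp [f, Matrix.one_apply, apply_ite φ]
    rwa [h2] at h1
  exact sub_eq_zero.1 (congrArg Subtype.val (hk _ h))

/-- For any polycyclic subgroup `Γ` of `GL_m(ℝ)` there is a subgroup of countable index
in `GL_m(ℝ)` which intersects `Γ` trivially. -/
theorem exists_countable_index_subgroup_avoiding_polycyclic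
    (m : ℕ) (hm : 0 < m) (Γ : Subgroup (Matrix.GeneralLinearGroup (Fin m) ℝ))
    (hΓ : IsPolycyclic Γ) :
    ∃ H : Subgroup (Matrix.GeneralLinearGroup (Fin m) ℝ),
      Countable (Matrix.GeneralLinearGroup (Fin m) ℝ ⧸ H) ∧ H ⊓ Γ = ⊥ := by
  have := hΓ.countable
  exact exists_countable_index_subgroup_inf_eq_bot_of_countable Cardinal.mk_real.le Γ
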